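/- For every n ≥ 3, the Stanley depth of the family P of cyclically independent subsets of [n] is at least ⌈(n−1)/3⌉; that is, there exists a partition of P into intervals [F_i,G_i] with |G_i| ≥ ⌈(n−1)/3⌉ for every i. -/

import Mathlib

/-- A subset `σ` of `[n] = {1,…,n}` is *cyclically independent* if it is an
independent set of the cycle graph `C_n`: it contains no pair `{i, i+1}` with
`1 ≤ i ≤ n-1`, and it does not contain both `1` and `n`. -/
def CyclicIndep (n : ℕ) (σ : Finset ℕ) : Prop :=
  σ ⊆ Finset.Icc 1 n ∧
    (∀ i : ℕ, 1 ≤ i → i ≤ n - 1 → ¬(i ∈ σ ∧ i + 1 ∈ σ)) ∧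
    ¬(1 ∈ σ ∧ n ∈ σ)

/-- A partition of a family `P` of subsets of `[n] = {1,…,n}` into finitely many
pairwise disjoint intervals `[F i, G i] = {σ : F i ⊆ σ ⊆ G i}`, each contained in
`P`, whose union is `P`.  (The interval `[F, G]` is `Finset.Icc F G`.) -/
structure IntervalPartition (n : ℕ) (P : Set (Finset ℕ)) where
  r : ℕ
  F : Fin r → Finset ℕ
  G : Fin r → Finset ℕ
  le : ∀ i, F i ⊆ G i
  sub : ∀ i, G i ⊆ Finset.Icc 1 n
  disj : ∀ i j, i ≠ j → Disjoint (Finset.Icc (F i) (G i)) (Finset.Icc (F j) (G j))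
  cover : ∀ σ : Finset ℕ, σ ∈ P ↔ ∃ i, σ ∈ Finset.Icc (F i) (G i)

/-- The sdepth of a partition `P = ⋃ i, [F i, G i]` is `min i, |G i|`; the Stanley
depth of `P` is the maximum of this quantity over all interval partitions of `P`,
i.e. the largest `k` such that `P` admits a partition all of whose upper ends `G i`
have at least `k` elements. -/
noncomputable def stanleyDepth (n : ℕ) (P : Set (Finset ℕ)) : ℕ :=
  sSup {k : ℕ | ∃ part : IntervalPartition n P, ∀ i, k ≤ (part.G i).card}

/-- `P` is a disjoint union of finitely many intervals `[F i, G i]` with `k ≤ |G i|`. -/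
def HasIntervalPartition (k : ℕ) (P : Set (Finset ℕ)) : Prop :=
  ∃ (ι : Type) (_ : Fintype ι) (F G : ι → Finset ℕ),
    (∀ i, F i ⊆ G i ∧ k ≤ (G i).card) ∧
    (∀ i j σ, F i ⊆ σ → σ ⊆ G i → F j ⊆ σ → σ ⊆ G j → i = j) ∧
    ∀ σ, σ ∈ P ↔ ∃ i, F i ⊆ σ ∧ σ ⊆ G i

namespace HasIntervalPartition

variable {k l : ℕ} {P Q : Set (Finset ℕ)}

lemma mono (hkl : k ≤ l) (h : HasIntervalPartition l P) : HasIntervalPartition k P := by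
  obtain ⟨ι, _, F, G, h₁, h₂, h₃⟩ := h
  exact ⟨ι, inferInstance, F, G, fun i => ⟨(h₁ i).1, hkl.trans (h₁ i).2⟩, h₂, h₃⟩

lemma singleton_empty : HasIntervalPartition 0 {∅} :=
  ⟨Unit, inferInstance, fun _ => ∅, fun _ => ∅, by simp, by simp, by simp⟩

lemma union (hP : HasIntervalPartition k P) (hQ : HasIntervalPartition k Q)
    (hPQ : ∀ σ ∈ P, σ ∉ Q) : HasIntervalPartition k (P ∪ Q) := by
  obtain ⟨ι, _, F, G, h₁, h₂, h₃⟩ := hP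
  obtain ⟨κ, _, F', G', h₁', h₂', h₃'⟩ := hQ
  refine ⟨ι ⊕ κ, inferInstance, Sum.elim F F', Sum.elim G G', ?_, ?_, ?_⟩
  · rintro (i | i)
    · exact h₁ i
    · exact h₁' i
  · rintro (i | i) (j | j) σ a b c d
    · exact congrArg _ (h₂ i j σ a b c d)
    · exact absurd ((h₃' σ).2 ⟨j, c, d⟩) (hPQ σ ((h₃ σ).2 ⟨i, a, b⟩))
    · exact absurd ((h₃' σ).2 ⟨i, a, b⟩) (hPQ σ ((h₃ σ).2 ⟨j, c, d⟩))
    · exact congrArg _ (h₂' i j σ a b c d)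
  · intro σ
    simp [h₃, h₃']

/-- Adjoining a new element `v` to every member of the family. -/
lemma adjoin (v : ℕ) (hP : HasIntervalPartition k P) (hv : ∀ σ ∈ P, v ∉ σ) :
    HasIntervalPartition (k + 1) {σ | v ∈ σ ∧ σ.erase v ∈ P} := by
  obtain ⟨ι, _, F, G, h₁, h₂, h₃⟩ := hP
  have hG : ∀ i, v ∉ G i := fun i => hv _ ((h₃ _).2 ⟨i, (h₁ i).1, subset_rfl⟩)
  have hF : ∀ i, v ∉ F i := fun i h => hG i ((h₁ i).1 h)
  have key : ∀ i σ, (insert v (F i) ⊆ σ ∧ σ ⊆ insert v (G i)) ↔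
      v ∈ σ ∧ F i ⊆ σ.erase v ∧ σ.erase v ⊆ G i := by
    intro i σ
    rw [Finset.insert_subset_iff, Finset.subset_insert_iff, Finset.subset_erase]
    have := hF i
    tauto
  refine ⟨ι, inferInstance, fun i => insert v (F i), fun i => insert v (G i), ?_, ?_, ?_⟩
  · intro i
    exact ⟨Finset.insert_subset_insert _ (h₁ i).1, by
      rw [Finset.card_insert_of_notMem (hG i)]
      exact Nat.succ_le_succ (h₁ i).2⟩
  · intro i j σ a b c d
    have hi := (key i σ).1 ⟨a, b⟩
    have hj := (key j σ).1 ⟨c, d⟩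
    exact h₂ i j _ hi.2.1 hi.2.2 hj.2.1 hj.2.2
  · intro σ
    simp only [key, Set.mem_ofPred_eq, h₃, exists_and_left]

/-- Making `v` a free element: the join of the family with the full simplex on `v`. -/
lemma cone (v : ℕ) (hP : HasIntervalPartition k P) (hv : ∀ σ ∈ P, v ∉ σ) :
    HasIntervalPartition (k + 1) {σ | σ.erase v ∈ P} := by
  obtain ⟨ι, _, F, G, h₁, h₂, h₃⟩ := hP
  have hG : ∀ i, v ∉ G i := fun i => hv _ ((h₃ _).2 ⟨i, (h₁ i).1, subset_rfl⟩)
  have hF : ∀ i, v ∉ F i := fun i h => hG i ((h₁ i).1 h)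
  have key : ∀ i σ, (F i ⊆ σ ∧ σ ⊆ insert v (G i)) ↔ F i ⊆ σ.erase v ∧ σ.erase v ⊆ G i := by
    intro i σ
    rw [Finset.subset_insert_iff, Finset.subset_erase]
    have := hF i
    tauto
  refine ⟨ι, inferInstance, F, fun i => insert v (G i), ?_, ?_, ?_⟩
  · intro i
    exact ⟨(h₁ i).1.trans (Finset.subset_insert _ _), by
      rw [Finset.card_insert_of_notMem (hG i)]
      exact Nat.succ_le_succ (h₁ i).2⟩
  · intro i j σ a b c d
    have hi := (key i σ).1 ⟨a, b⟩
    have hj := (key j σ).1 ⟨c, d⟩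
    exact h₂ i j _ hi.1 hi.2 hj.1 hj.2
  · intro σ
    simp only [key, Set.mem_ofPred_eq, h₃]

lemma exists_intervalPartition {n : ℕ} (hP : HasIntervalPartition k P)
    (hn : ∀ σ ∈ P, σ ⊆ Finset.Icc 1 n) :
    ∃ part : IntervalPartition n P, ∀ i, k ≤ (part.G i).card := by
  obtain ⟨ι, _, F, G, h₁, h₂, h₃⟩ := hP
  let e := (Fintype.equivFin ι).symm
  refine ⟨⟨Fintype.card ι, F ∘ e, G ∘ e, fun i => (h₁ _).1,
    fun i => hn _ ((h₃ _).2 ⟨e i, (h₁ _).1, subset_rfl⟩), ?_, ?_⟩, fun i => (h₁ _).2⟩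
  · intro i j hij
    rw [Finset.disjoint_left]
    intro σ hi hj
    rw [Finset.mem_Icc] at hi hj
    exact hij (e.injective (h₂ _ _ σ hi.1 hi.2 hj.1 hj.2))
  · intro σ
    simp only [Finset.mem_Icc, Function.comp_apply, h₃]
    exact e.surjective.exists (p := fun i => F i ⊆ σ ∧ σ ⊆ G i)

end HasIntervalPartition

/-- The independent sets of the path on the vertices `a, a + 1, …, a + m - 1`. -/
def pathIndep (a m : ℕ) : Set (Finset ℕ) :=
  {σ | (∀ i ∈ σ, a ≤ i ∧ i < a + m) ∧ ∀ i ∈ σ, i + 1 ∉ σ}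

lemma hasIntervalPartition_pathIndep (a m : ℕ) :
    HasIntervalPartition ((m + 2) / 3) (pathIndep a m) := by
  induction m using Nat.strong_induction_on with
  | _ m ih =>
    obtain rfl | rfl | ⟨m, rfl⟩ : m = 0 ∨ m = 1 ∨ ∃ k, m = k + 2 := by
      rcases m with _ | _ | m <;> simp
    · convert HasIntervalPartition.singleton_empty using 1
      ext σ
      simp only [pathIndep, Set.mem_ofPred_eq, Set.mem_singleton_iff]
      constructor
      · intro h
        exact Finset.eq_empty_of_forall_notMem fun i hi => by have := h.1 i hi; omega
      · rintro rfl
        simp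
    · convert (ih 0 (by omega)).cone a (fun σ hσ h => by have := hσ.1 a h; omega) using 1
      ext σ
      simp only [pathIndep, Set.mem_ofPred_eq, Finset.mem_erase]
      grind
    · have h₁ := (ih (m - 1) (by omega)).adjoin (a + m)
        (fun σ hσ h => by have := hσ.1 _ h; omega)
      have h₂ := (ih m (by omega)).cone (a + m + 1)
        (fun σ hσ h => by have := hσ.1 _ h; omega)
      convert (h₁.mono (k := (m + 2 + 2) / 3) (by omega)).union
        (h₂.mono (by omega)) ?_ using 1
      · ext σ
        simp only [pathIndep, Set.mem_ofPred_eq, Finset.mem_erase, Set.mem_union]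
        constructor
        · rintro ⟨hb, hs⟩
          by_cases hv : a + m ∈ σ
          · refine Or.inl ⟨hv, fun i hi => ?_, by grind⟩
            have h₃ : i ≠ a + m + 1 := fun h => hs _ hv (h ▸ hi.2)
            have h₄ : i + 1 ≠ a + m := fun h => hs _ hi.2 (h ▸ hv)
            have := hb i hi.2
            omega
          · refine Or.inr ⟨fun i hi => ?_, by grind⟩
            have h₃ : i ≠ a + m := fun h => hv (h ▸ hi.2)
            have := hb i hi.2
            omega
        · grind
      · intro σ hσ hσ'
        have := hσ'.1 (a + m) (Finset.mem_erase.2 ⟨by omega, hσ.1⟩)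
        omega

lemma hasIntervalPartition_cyclicIndep {n : ℕ} (hn : 3 ≤ n) :
    HasIntervalPartition ((n + 1) / 3) {σ | CyclicIndep n σ} := by
  have h₁ := (hasIntervalPartition_pathIndep 2 (n - 3)).adjoin n
    (fun σ hσ h => by have := hσ.1 _ h; omega)
  have h₂ := hasIntervalPartition_pathIndep 1 (n - 1)
  convert (h₁.mono (k := (n + 1) / 3) (by omega)).union (h₂.mono (by omega)) ?_ using 1
  · ext σ
    simp only [CyclicIndep, pathIndep, Set.mem_ofPred_eq, Finset.mem_erase, Set.mem_union,
      Finset.subset_iff, Finset.mem_Icc]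
    constructor
    · grind
    · grind
  · intro σ hσ hσ'
    have := hσ'.1 n hσ.1
    omega

lemma le_stanleyDepth {n k : ℕ} {P : Set (Finset ℕ)} (hP : P.Nonempty)
    (h : ∃ part : IntervalPartition n P, ∀ i, k ≤ (part.G i).card) : k ≤ stanleyDepth n P := by
  refine le_csSup ⟨n, ?_⟩ h
  rintro l ⟨part, hl⟩
  obtain ⟨σ, hσ⟩ := hP
  obtain ⟨i, -⟩ := (part.cover σ).1 hσ
  simpa using (hl i).trans (Finset.card_le_card (part.sub i))

/-- For every `n ≥ 3`, the Stanley depth of the family of cyclically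
independent subsets of `[n]` is at least `⌈(n-1)/3⌉` (which is `(n+1)/3` in
ℕ-division); that is, there exists a partition of this family into intervals
`[F i, G i]` with `|G i| ≥ ⌈(n-1)/3⌉` for every `i`. -/
theorem stmt_3 (n : ℕ) (hn : 3 ≤ n) :
    (n + 1) / 3 ≤ stanleyDepth n {σ : Finset ℕ | CyclicIndep n σ} ∧
      ∃ part : IntervalPartition n {σ : Finset ℕ | CyclicIndep n σ},
        ∀ i, (n + 1) / 3 ≤ (part.G i).card := by
  have h := (hasIntervalPartition_cyclicIndep hn).exists_intervalPartition fun σ hσ => hσ.1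
  exact ⟨le_stanleyDepth ⟨∅, by simp [CyclicIndep]⟩ h, h⟩
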